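/- Let u : ℝⁿ → ℝ be a biharmonic function (Δ²u = 0 on ℝⁿ) of sublinear growth, i.e. sup_{B_r}|u| = o(r) as r → ∞. Then u is constant. -/

import Mathlib

open MeasureTheory Metric Filter
open scoped Topology RealInnerProductSpace

/-- The Euclidean Laplacian of `f : ℝⁿ → ℝ`. -/
noncomputable def lap {n : ℕ} (f : EuclideanSpace ℝ (Fin n) → ℝ)
    (x : EuclideanSpace ℝ (Fin n)) : ℝ :=
  ∑ i : Fin n,
    fderiv ℝ (fun y => fderiv ℝ f y (EuclideanSpace.single i 1)) x (EuclideanSpace.single i 1)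

theorem hasDerivAt_integral_mul_of_hasCompactSupport {X : Type*} [TopologicalSpace X]
    [MeasurableSpace X] [OpensMeasurableSpace X] [T2Space X] {μ : Measure X}
    [IsFiniteMeasureOnCompacts μ] {G G' : ℝ → X → ℝ} {w : X → ℝ}
    (hG : Continuous fun p : ℝ × X => G p.1 p.2) (hG' : Continuous fun p : ℝ × X => G' p.1 p.2)
    (hderiv : ∀ t y, HasDerivAt (fun s => G s y) (G' t y) t)
    (hw : Continuous w) (hw' : HasCompactSupport w) (t : ℝ) :
    HasDerivAt (fun s => ∫ y, G s y * w y ∂μ) (∫ y, G' t y * w y ∂μ) t := by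
  have hint : ∀ {H : ℝ → X → ℝ}, Continuous (fun p : ℝ × X => H p.1 p.2) → ∀ s,
      Integrable (fun y => H s y * w y) μ := fun {H} hH s =>
    ((hH.comp (Continuous.prodMk_right s)).mul hw).integrable_of_hasCompactSupport
      (hw'.mul_left (f := fun y => H s y))
  obtain ⟨C, hC⟩ := ((isCompact_closedBall t 1).prod hw').exists_bound_of_continuousOn
    hG'.continuousOn
  refine (hasDerivAt_integral_of_dominated_loc_of_deriv_le (bound := fun y => C * ‖w y‖)
    (closedBall_mem_nhds t one_pos) (Eventually.of_forall fun s => (hint hG s).1) (hint hG t)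
    (hint hG' t).1 (Eventually.of_forall fun y s hs => ?_)
    ((hw.integrable_of_hasCompactSupport hw').norm.const_mul C)
    (Eventually.of_forall fun y s _ => (hderiv s y).mul_const _)).2
  by_cases hy : w y = 0
  · simp [hy]
  · rw [norm_mul]
    gcongr
    exact hC (s, y) ⟨hs, subset_tsupport w hy⟩

theorem hasDerivAt_max_one_sub_pow (k : ℕ) (s : ℝ) :
    HasDerivAt (fun s : ℝ => max (1 - s) 0 ^ (k + 2))
      (-(k + 2) * max (1 - s) 0 ^ (k + 1)) s := by
  refine hasDerivAt_of_hasDerivAt_of_ne' (x := 1)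
    (g := fun s : ℝ => -(k + 2) * max (1 - s) 0 ^ (k + 1)) (fun y hy => ?_) (by fun_prop)
    (by fun_prop) s
  rcases lt_or_gt_of_ne hy with h | h
  · have h1 := ((hasDerivAt_id y).const_sub 1).pow (k + 2)
    rw [max_eq_left (by linarith)]
    refine (h1.congr_of_eventuallyEq ?_).congr_deriv ?_
    · filter_upwards [Iio_mem_nhds h] with z hz
      simp [max_eq_left (show (0 : ℝ) ≤ 1 - z by linarith [Set.mem_Iio.1 hz])]
    · simp
      ring
  · rw [max_eq_right (by linarith)]
    refine ((hasDerivAt_const y (0 : ℝ)).congr_of_eventuallyEq ?_).congr_deriv (by simp)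
    filter_upwards [Ioi_mem_nhds h] with z hz
    simp [max_eq_right (show 1 - z ≤ (0 : ℝ) by linarith [Set.mem_Ioi.1 hz])]

/-- The radial weight `(1 - ‖y‖²)₊ ^ k`. -/
noncomputable def radialWeight {n : ℕ} (k : ℕ) (y : EuclideanSpace ℝ (Fin n)) : ℝ :=
  max (1 - ‖y‖ ^ 2) 0 ^ k

section radialWeight

variable {n : ℕ}

@[fun_prop]
theorem continuous_radialWeight (k : ℕ) :
    Continuous (radialWeight k : EuclideanSpace ℝ (Fin n) → ℝ) := by
  unfold radialWeight
  fun_prop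

theorem radialWeight_eq_zero {k : ℕ} (hk : k ≠ 0) {y : EuclideanSpace ℝ (Fin n)}
    (hy : y ∉ closedBall (0 : EuclideanSpace ℝ (Fin n)) 1) : radialWeight k y = 0 := by
  rw [mem_closedBall_zero_iff, not_le] at hy
  rw [radialWeight, max_eq_right (by nlinarith), zero_pow hk]

theorem hasCompactSupport_radialWeight {k : ℕ} (hk : k ≠ 0) :
    HasCompactSupport (radialWeight k : EuclideanSpace ℝ (Fin n) → ℝ) :=
  HasCompactSupport.intro (isCompact_closedBall 0 1) fun _ hy => radialWeight_eq_zero hk hy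

theorem integral_radialWeight_pos {k : ℕ} (hk : k ≠ 0) :
    0 < ∫ y : EuclideanSpace ℝ (Fin n), radialWeight k y :=
  (continuous_radialWeight k).integral_pos_of_hasCompactSupport_nonneg_nonzero
    (hasCompactSupport_radialWeight hk) (fun y => by simp only [radialWeight]; positivity)
    (x := 0) (by simp [radialWeight])

theorem hasFDerivAt_radialWeight (k : ℕ) (y : EuclideanSpace ℝ (Fin n)) :
    HasFDerivAt (radialWeight (k + 2))
      ((-2 * (k + 2) * radialWeight (k + 1) y) • innerSL ℝ y) y := by
  have h := (hasDerivAt_max_one_sub_pow k (‖y‖ ^ 2)).comp_hasFDerivAt y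
    (hasStrictFDerivAt_norm_sq y).hasFDerivAt
  refine h.congr_fderiv ?_
  ext v
  simp [radialWeight]
  ring

theorem differentiable_radialWeight (k : ℕ) :
    Differentiable ℝ (radialWeight (k + 2) : EuclideanSpace ℝ (Fin n) → ℝ) :=
  fun y => (hasFDerivAt_radialWeight k y).differentiableAt

theorem fderiv_radialWeight (k : ℕ) (y v : EuclideanSpace ℝ (Fin n)) :
    fderiv ℝ (radialWeight (k + 2)) y v = -2 * (k + 2) * radialWeight (k + 1) y * ⟪y, v⟫ := by
  simp [(hasFDerivAt_radialWeight k y).fderiv]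

end radialWeight

section dilation

variable {n : ℕ} {f : EuclideanSpace ℝ (Fin n) → ℝ}

theorem fderiv_comp_add_smul (hf : Differentiable ℝ f) (x y v : EuclideanSpace ℝ (Fin n)) (r : ℝ) :
    fderiv ℝ (fun y => f (x + r • y)) y v = r * fderiv ℝ f (x + r • y) v := by
  have h : HasFDerivAt (fun y => x + r • y)
      (r • ContinuousLinearMap.id ℝ (EuclideanSpace ℝ (Fin n))) y :=
    ((hasFDerivAt_id y).const_smul r).const_add x
  have h' := (hf (x + r • y)).hasFDerivAt.comp y h
  rw [show (fun y => f (x + r • y)) = f ∘ fun y => x + r • y from rfl, h'.fderiv]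
  simp

theorem integral_comp_mul_fderiv_radialWeight (hf : ContDiff ℝ 1 f) (k : ℕ)
    (x v : EuclideanSpace ℝ (Fin n)) (r : ℝ) :
    ∫ y, f (x + r • y) * fderiv ℝ (radialWeight (k + 2)) y v =
      -(r * ∫ y, fderiv ℝ f (x + r • y) v * radialWeight (k + 2) y) := by
  have hf0 := hf.continuous
  have hf' : Continuous (fderiv ℝ f) := hf.continuous_fderiv one_ne_zero
  have hfd := hf.differentiable one_ne_zero
  rw [integral_mul_fderiv_eq_neg_fderiv_mul_of_integrable (f := fun y => f (x + r • y))]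
  · simp_rw [fderiv_comp_add_smul hfd, mul_assoc, integral_const_mul]
  · simp_rw [fderiv_comp_add_smul hfd]
    exact (Continuous.integrable_of_hasCompactSupport (by fun_prop)
      ((hasCompactSupport_radialWeight (by lia)).mul_left))
  · simp_rw [fderiv_radialWeight]
    refine Continuous.integrable_of_hasCompactSupport (by fun_prop)
      (HasCompactSupport.intro (isCompact_closedBall 0 1) fun y hy => ?_)
    simp [radialWeight_eq_zero (Nat.succ_ne_zero k) hy]
  · exact (Continuous.integrable_of_hasCompactSupport (by fun_prop)
      ((hasCompactSupport_radialWeight (by lia)).mul_left))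
  · exact fun y _ => by fun_prop
  · exact fun y _ => differentiable_radialWeight k y

theorem integral_fderiv_comp_self_mul_radialWeight (hf : ContDiff ℝ 2 f) (k : ℕ)
    (x : EuclideanSpace ℝ (Fin n)) (r : ℝ) :
    ∫ y, fderiv ℝ f (x + r • y) y * radialWeight (k + 1) y =
      r / (2 * (k + 2)) * ∫ y, lap f (x + r • y) * radialWeight (k + 2) y := by
  have hpart (i : Fin n) : ContDiff ℝ 1 fun y => fderiv ℝ f y (EuclideanSpace.single i 1) :=
    (hf.fderiv_right (m := 1) (by norm_num)).clm_apply contDiff_const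
  have hpart' (i : Fin n) : Continuous fun y =>
      fderiv ℝ (fun y => fderiv ℝ f y (EuclideanSpace.single i 1)) y
        (EuclideanSpace.single i 1) :=
    ((hpart i).continuous_fderiv one_ne_zero).clm_apply continuous_const
  have hpt (y : EuclideanSpace ℝ (Fin n)) :
      fderiv ℝ f (x + r • y) y * radialWeight (k + 1) y =
        -(1 / (2 * (k + 2))) * ∑ i, fderiv ℝ f (x + r • y) (EuclideanSpace.single i 1) *
          fderiv ℝ (radialWeight (k + 2)) y (EuclideanSpace.single i 1) := by
    have hy : y = ∑ i, y i • EuclideanSpace.single i (1 : ℝ) := by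
      simpa using ((EuclideanSpace.basisFun (Fin n) ℝ).sum_repr y).symm
    conv_lhs => rw [hy, map_sum, ← hy]
    rw [Finset.sum_mul, Finset.mul_sum]
    refine Finset.sum_congr rfl fun i _ => ?_
    rw [fderiv_radialWeight, map_smul, EuclideanSpace.inner_single_right]
    simp
    field_simp
  simp_rw [hpt, integral_const_mul, lap, Finset.sum_mul]
  rw [integral_finsetSum, integral_finsetSum]
  · simp_rw [integral_comp_mul_fderiv_radialWeight (hpart _), Finset.sum_neg_distrib,
      ← Finset.mul_sum]
    ring
  · exact fun i _ => Continuous.integrable_of_hasCompactSupport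
      (((hpart' i).comp (by fun_prop)).mul (by fun_prop))
      ((hasCompactSupport_radialWeight (by lia)).mul_left)
  · intro i _
    simp_rw [fderiv_radialWeight]
    refine Continuous.integrable_of_hasCompactSupport
      (((hpart i).continuous.comp (by fun_prop)).mul (by fun_prop))
      (HasCompactSupport.intro (isCompact_closedBall 0 1) fun y hy => ?_)
    simp [radialWeight_eq_zero (Nat.succ_ne_zero k) hy]

theorem hasDerivAt_integral_comp_mul_radialWeight (hf : ContDiff ℝ 2 f) (k : ℕ)
    (x : EuclideanSpace ℝ (Fin n)) (r : ℝ) :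
    HasDerivAt (fun r => ∫ y, f (x + r • y) * radialWeight (k + 1) y)
      (r / (2 * (k + 2)) * ∫ y, lap f (x + r • y) * radialWeight (k + 2) y) r := by
  rw [← integral_fderiv_comp_self_mul_radialWeight hf]
  have hf0 := hf.continuous
  have hf' : Continuous (fderiv ℝ f) := hf.continuous_fderiv two_ne_zero
  refine hasDerivAt_integral_mul_of_hasCompactSupport (G := fun r y => f (x + r • y))
    (G' := fun r y => fderiv ℝ f (x + r • y) y) (by fun_prop) (by fun_prop) (fun t y => ?_)
    (by fun_prop) (hasCompactSupport_radialWeight (by lia)) r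
  have h : HasDerivAt (fun s : ℝ => x + s • y) y t := by
    simpa using ((hasDerivAt_id t).smul_const y).const_add x
  exact ((hf.differentiable two_ne_zero) _).hasFDerivAt.comp_hasDerivAt t h

/-- Weighted mean value property of harmonic functions. -/
theorem integral_comp_mul_radialWeight_of_lap_eq_zero (hf : ContDiff ℝ 2 f)
    (hlap : ∀ x, lap f x = 0) (k : ℕ) (x : EuclideanSpace ℝ (Fin n)) (r : ℝ) :
    ∫ y, f (x + r • y) * radialWeight (k + 1) y =
      f x * ∫ y : EuclideanSpace ℝ (Fin n), radialWeight (k + 1) y := by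
  have hd := hasDerivAt_integral_comp_mul_radialWeight hf k x
  simp only [hlap, zero_mul, integral_zero, mul_zero] at hd
  have := is_const_of_deriv_eq_zero (fun r => (hd r).differentiableAt) (fun r => (hd r).deriv) r 0
  simpa [integral_const_mul] using this

/-- Pizzetti's formula for biharmonic functions, with a radial weight. -/
theorem integral_comp_mul_radialWeight_of_lap_lap_eq_zero (hf : ContDiff ℝ 2 f)
    (hf' : ContDiff ℝ 2 (lap f)) (hlap : ∀ x, lap (lap f) x = 0) (k : ℕ)
    (x : EuclideanSpace ℝ (Fin n)) (r : ℝ) :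
    ∫ y, f (x + r • y) * radialWeight (k + 1) y =
      f x * (∫ y : EuclideanSpace ℝ (Fin n), radialWeight (k + 1) y) +
        r ^ 2 / (4 * (k + 2)) *
          (lap f x * ∫ y : EuclideanSpace ℝ (Fin n), radialWeight (k + 2) y) := by
  have hd := hasDerivAt_integral_comp_mul_radialWeight hf k x
  simp only [integral_comp_mul_radialWeight_of_lap_eq_zero hf' hlap] at hd
  set c := lap f x * ∫ y : EuclideanSpace ℝ (Fin n), radialWeight (k + 2) y
  have hd' (r : ℝ) : HasDerivAt (fun r => (∫ y, f (x + r • y) * radialWeight (k + 1) y) -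
      r ^ 2 / (4 * (k + 2)) * c) 0 r := by
    refine ((hd r).sub ((((hasDerivAt_id r).pow 2).div_const (4 * ((k : ℝ) + 2))).mul_const
      c)).congr_deriv ?_
    simp
    field_simp
    ring
  have := is_const_of_deriv_eq_zero (fun r => (hd' r).differentiableAt)
    (fun r => (hd' r).deriv) r 0
  simp only [zero_smul, add_zero, integral_const_mul] at this
  linear_combination this

end dilation

theorem abs_le_iSup_ball {n : ℕ} {u : EuclideanSpace ℝ (Fin n) → ℝ} (hu : Continuous u) {r : ℝ}
    {x : EuclideanSpace ℝ (Fin n)} (hx : x ∈ ball (0 : EuclideanSpace ℝ (Fin n)) r) :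
    |u x| ≤ ⨆ x ∈ ball (0 : EuclideanSpace ℝ (Fin n)) r, |u x| := by
  obtain ⟨C, hC⟩ :=
    (isCompact_closedBall (0 : EuclideanSpace ℝ (Fin n)) r).exists_bound_of_continuousOn
      hu.continuousOn
  have hC0 : 0 ≤ C := (norm_nonneg _).trans (hC x (ball_subset_closedBall hx))
  refine le_ciSup_of_le ⟨C, ?_⟩ x (by rw [ciSup_pos hx])
  rintro _ ⟨z, rfl⟩
  exact Real.iSup_le (fun hz => hC z (ball_subset_closedBall hz)) hC0

theorem isLittleO_integral_comp_mul {n : ℕ} {u h : EuclideanSpace ℝ (Fin n) → ℝ}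
    (hu : Continuous u) (hh : Integrable h)
    (hsupp : ∀ y ∉ closedBall (0 : EuclideanSpace ℝ (Fin n)) 1, h y = 0)
    (hgrowth : (fun r : ℝ => ⨆ x ∈ ball (0 : EuclideanSpace ℝ (Fin n)) r, |u x|) =o[atTop]
      (fun r : ℝ => r)) (x : EuclideanSpace ℝ (Fin n)) :
    (fun r : ℝ => ∫ y, u (x + r • y) * h y) =o[atTop] (fun r : ℝ => r) := by
  set S : ℝ → ℝ := fun r => ⨆ x ∈ ball (0 : EuclideanSpace ℝ (Fin n)) r, |u x| with hS
  have hshift : Tendsto (fun r : ℝ => r + (‖x‖ + 1)) atTop atTop :=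
    tendsto_atTop_add_const_right _ _ tendsto_id
  have h1 : (fun r => S (r + (‖x‖ + 1))) =o[atTop] (fun r : ℝ => r) := by
    refine (hgrowth.comp_tendsto hshift).trans_isBigO ?_
    exact (Asymptotics.isBigO_refl _ _).add
      (Asymptotics.isLittleO_const_id_atTop _).isBigO
  refine Asymptotics.IsBigO.trans_isLittleO ?_ h1
  refine Asymptotics.IsBigO.of_bound (∫ y, ‖h y‖) ?_
  filter_upwards [eventually_ge_atTop 0] with r hr
  rw [mul_comm, ← integral_const_mul]
  refine norm_integral_le_of_norm_le (hh.norm.const_mul _) (Eventually.of_forall fun y => ?_)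
  by_cases hy : y ∈ closedBall (0 : EuclideanSpace ℝ (Fin n)) 1
  · rw [norm_mul]
    gcongr
    refine (abs_le_iSup_ball hu (r := r + (‖x‖ + 1)) ?_).trans (le_abs_self _)
    rw [mem_closedBall_zero_iff] at hy
    rw [mem_ball_zero_iff]
    calc ‖x + r • y‖ ≤ ‖x‖ + ‖r • y‖ := norm_add_le _ _
      _ = ‖x‖ + r * ‖y‖ := by rw [norm_smul, Real.norm_of_nonneg hr]
      _ < r + (‖x‖ + 1) := by nlinarith
  · simp [hsupp y hy]

theorem ContDiff.lap {n : ℕ} {u : EuclideanSpace ℝ (Fin n) → ℝ}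
    (hu : ContDiff ℝ (⊤ : ℕ∞) u) : ContDiff ℝ (⊤ : ℕ∞) (lap u) := by
  unfold _root_.lap
  refine ContDiff.sum fun i _ => ?_
  have h1 : ContDiff ℝ (⊤ : ℕ∞) fun y => fderiv ℝ u y (EuclideanSpace.single i 1) :=
    (hu.fderiv_right (by simp)).clm_apply contDiff_const
  exact (h1.fderiv_right (by simp)).clm_apply contDiff_const

theorem eq_zero_of_const_mul_isLittleO {a : ℝ} {g : ℝ → ℝ}
    (h : (fun r => a * g r) =o[atTop] g) (hg : ∀ᶠ r in atTop, g r ≠ 0) : a = 0 := by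
  by_contra ha
  have h' := (Asymptotics.isLittleO_const_mul_left_iff ha).1 h
  exact Asymptotics.isLittleO_irrefl hg.frequently h'

/-- A biharmonic function of sublinear growth is harmonic. -/
theorem lap_eq_zero_of_biharmonic_of_sublinear {n : ℕ} {u : EuclideanSpace ℝ (Fin n) → ℝ}
    (hu : ContDiff ℝ (⊤ : ℕ∞) u) (hbi : ∀ x, lap (lap u) x = 0)
    (hgrowth : (fun r : ℝ => ⨆ x ∈ ball (0 : EuclideanSpace ℝ (Fin n)) r, |u x|) =o[atTop]
      (fun r : ℝ => r)) (x : EuclideanSpace ℝ (Fin n)) : lap u x = 0 := by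
  have ho := isLittleO_integral_comp_mul hu.continuous
    ((continuous_radialWeight 1).integrable_of_hasCompactSupport
      (hasCompactSupport_radialWeight one_ne_zero))
    (fun y hy => radialWeight_eq_zero one_ne_zero hy) hgrowth x
  have hpiz := integral_comp_mul_radialWeight_of_lap_lap_eq_zero (contDiff_infty.1 hu 2)
    (contDiff_infty.1 hu.lap 2) hbi 0 x
  simp only [zero_add] at hpiz
  simp only [hpiz] at ho
  have hpow : (fun r : ℝ => r) =o[atTop] fun r : ℝ => r ^ 2 := by
    simpa using Asymptotics.isLittleO_pow_pow_atTop_of_lt (𝕜 := ℝ) one_lt_two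
  have hconst := (Asymptotics.isLittleO_const_id_atTop
    (u x * ∫ y : EuclideanSpace ℝ (Fin n), radialWeight 1 y)).trans hpow
  have hsub := (ho.trans hpow).sub hconst
  have hzero := eq_zero_of_const_mul_isLittleO (g := fun r : ℝ => r ^ 2)
    (a := 1 / 8 * (lap u x * ∫ y : EuclideanSpace ℝ (Fin n), radialWeight 2 y))
    (hsub.congr_left fun r => by push_cast; ring)
    ((eventually_ne_atTop 0).mono fun r hr => pow_ne_zero 2 hr)
  have hpos := integral_radialWeight_pos (n := n) two_ne_zero
  simpa [hpos.ne'] using hzero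

/-- A harmonic function of sublinear growth has vanishing derivative. -/
theorem fderiv_eq_zero_of_harmonic_of_sublinear {n : ℕ} {u : EuclideanSpace ℝ (Fin n) → ℝ}
    (hu : ContDiff ℝ 2 u) (hlap : ∀ x, lap u x = 0)
    (hgrowth : (fun r : ℝ => ⨆ x ∈ ball (0 : EuclideanSpace ℝ (Fin n)) r, |u x|) =o[atTop]
      (fun r : ℝ => r)) (x : EuclideanSpace ℝ (Fin n)) : fderiv ℝ u x = 0 := by
  ext v
  have hu0 := hu.continuous
  have hu' : Continuous (fderiv ℝ u) := hu.continuous_fderiv two_ne_zero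
  have hud := hu.differentiable two_ne_zero
  have hline (z : EuclideanSpace ℝ (Fin n)) (t : ℝ) :
      HasDerivAt (fun s : ℝ => u (z + s • v)) (fderiv ℝ u (z + t • v) v) t := by
    have h : HasDerivAt (fun s : ℝ => z + s • v) v t := by
      simpa using ((hasDerivAt_id t).smul_const v).const_add z
    exact (hud _).hasFDerivAt.comp_hasDerivAt t h
  have hmean (r : ℝ) : ∫ y, fderiv ℝ u (x + r • y) v * radialWeight 2 y =
      fderiv ℝ u x v * ∫ y : EuclideanSpace ℝ (Fin n), radialWeight 2 y := by
    have h1 := hasDerivAt_integral_mul_of_hasCompactSupport (μ := volume)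
      (G := fun s y => u (x + r • y + s • v)) (G' := fun s y => fderiv ℝ u (x + r • y + s • v) v)
      (by fun_prop) (by fun_prop) (fun t y => hline _ t) (continuous_radialWeight 2)
      (hasCompactSupport_radialWeight two_ne_zero) 0
    have h2 := (hline x 0).mul_const (∫ y : EuclideanSpace ℝ (Fin n), radialWeight 2 y)
    simp_rw [add_right_comm x _ (_ • v),
      integral_comp_mul_radialWeight_of_lap_eq_zero hu hlap 1] at h1
    simpa using h1.unique h2
  have ho := isLittleO_integral_comp_mul hu0 (h := fun y => fderiv ℝ (radialWeight 2) y v)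
    (by
      simp_rw [fderiv_radialWeight 0]
      refine Continuous.integrable_of_hasCompactSupport (by fun_prop)
        (HasCompactSupport.intro (isCompact_closedBall 0 1) fun y hy => ?_)
      simp [radialWeight_eq_zero one_ne_zero hy])
    (fun y hy => by simp [fderiv_radialWeight 0, radialWeight_eq_zero one_ne_zero hy])
    hgrowth x
  simp_rw [integral_comp_mul_fderiv_radialWeight (hu.of_le one_le_two) 0, zero_add, hmean] at ho
  have hzero := eq_zero_of_const_mul_isLittleO (g := fun r : ℝ => r)
    (a := -(fderiv ℝ u x v * ∫ y : EuclideanSpace ℝ (Fin n), radialWeight 2 y))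
    (ho.congr_left fun r => by ring) (eventually_ne_atTop 0)
  have hpos := integral_radialWeight_pos (n := n) two_ne_zero
  simpa [hpos.ne'] using hzero

/-- Biharmonic Liouville theorem: sublinear growth implies constant. -/
theorem biharmonic_sublinear_is_constant (n : ℕ)
    (u : EuclideanSpace ℝ (Fin n) → ℝ) (hu : ContDiff ℝ (⊤ : ℕ∞) u)
    (hbi : ∀ x, lap (lap u) x = 0)
    (hgrowth :
      (fun r : ℝ => ⨆ x ∈ ball (0 : EuclideanSpace ℝ (Fin n)) r, |u x|) =o[atTop]
        (fun r : ℝ => r)) :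
    ∃ c : ℝ, ∀ x, u x = c := by
  have hu2 : ContDiff ℝ 2 u := contDiff_infty.1 hu 2
  have hfderiv := fderiv_eq_zero_of_harmonic_of_sublinear hu2
    (lap_eq_zero_of_biharmonic_of_sublinear hu hbi hgrowth) hgrowth
  exact ⟨u 0, fun x => is_const_of_fderiv_eq_zero (hu2.differentiable two_ne_zero) hfderiv x 0⟩
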